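/- Assume κ_{m}(0,N) ≠ 0 for all m, and assume d̃_{n−1}² ≠ 0 where d̃_m² = d_m²(1 + Δ_m) with Δ_m = A R_m^{α,β,A,B}(0)_q R_m^{α,β}(0)_q / d_m² + B R_m^{α,β,A,B}(N)_q R_m^{α,β}(N)_q / d_m². Then for every integer n with 1 ≤ n ≤ N−1 and every s, the q-Racah–Krall polynomials satisfy the three-term recurrence relation x(s) R_n^{α,β,A,B}(s)_q = R_{n+1}^{α,β,A,B}(s)_q + β̃_n R_n^{α,β,A,B}(s)_q + γ̃_n R_{n−1}^{α,β,A,B}(s)_q, where β̃_n = β_n − A( R_n^{α,β,A,B}(0)_q R_{n−1}^{α,β}(0)_q / d_{n−1}² − R_{n+1}^{α,β,A,B}(0)_q R_n^{α,β}(0)_q / d_n² ) − B( R_n^{α,β,A,B}(N)_q R_{n−1}^{α,β}(N)_q / d_{n−1}² − R_{n+1}^{α,β,A,B}(N)_q R_n^{α,β}(N)_q / d_n² ) and γ̃_n = γ_n (1 + Δ_n)/(1 + Δ_{n−1}), with β_n = 1 + δγq − (1−αq^{n+1})(1−αβq^{n+1})(1−βδq^{n+1})(1−γq^{n+1}) /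 ((1−αβq^{2n+1})(1−αβq^{2n+2})) − q(1−q^n)(1−βq^n)(γ−αβq^n)(δ−αq^n) / ((1−αβq^{2n})(1−αβq^{2n+1})) and γ_n = [ (1−αq^n)(1−αβq^n)(1−βδq^n)(1−γq^n) / ((1−αβq^{2n−1})(1−αβq^{2n})) ] · [ q(1−q^n)(1−βq^n)(γ−αβq^n)(δ−αq^n) / ((1−αβq^{2n})(1−αβq^{2n+1})) ]. -/

import Mathlib

open Finset Filter

set_option autoImplicit false

noncomputable section

/-- The `q`-Pochhammer symbol `(a;q)_k = ∏_{i=0}^{k-1} (1 - a q^i)`. -/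
def qPoch (a q : ℂ) (k : ℕ) : ℂ := ∏ i ∈ Finset.range k, (1 - a * q ^ i)

/-- The lattice `x(s) = q^{-s} + δ γ q^{s+1}`. -/
def qLat (q γ δ : ℂ) (s : ℤ) : ℂ := q ^ (-s) + δ * γ * q ^ (s + 1)

/-- The standard (monic-normalized as in the paper) `q`-Racah polynomial
`R_n^{α,β}(s)_q` evaluated at an integer lattice point `s`. -/
def qRacah (q α β γ δ : ℂ) (n : ℕ) (s : ℤ) : ℂ :=
  (qPoch (α * q) q n * qPoch (β * δ * q) q n * qPoch (γ * q) q n /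
      qPoch (α * β * q ^ ((n : ℤ) + 1)) q n) *
    ∑ k ∈ Finset.range (n + 1),
      qPoch (q ^ (-(n : ℤ))) q k * qPoch (α * β * q ^ ((n : ℤ) + 1)) q k *
          qPoch (q ^ (-s)) q k * qPoch (δ * γ * q ^ (s + 1)) q k /
        (qPoch (α * q) q k * qPoch (β * δ * q) q k * qPoch (γ * q) q k * qPoch q q k) *
        q ^ k

/-- The squared norm `d_n²` of the standard `q`-Racah polynomials. -/
def qRacahNormSq (q α β γ δ : ℂ) (n : ℕ) : ℂ :=
  (1 - α * β * q) * (δ * γ * q) ^ n / (1 - α * β * q ^ (2 * (n : ℤ) + 1)) *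
    (qPoch (α * q) q n * qPoch (β * δ * q) q n * qPoch (γ * q) q n * qPoch q q n *
      qPoch (q * α * β * γ⁻¹) q n * qPoch (α * δ⁻¹ * q) q n * qPoch (β * q) q n) /
    (qPoch (α * β * q) q n * qPoch (α * β * q ^ ((n : ℤ) + 1)) q n *
      qPoch (α * β * q ^ ((n : ℤ) + 1)) q n)

/-- The kernel `K_{n-1}^{α,β}(s,t) = ∑_{k=0}^{n-1} R_k(s) R_k(t) / d_k²`
(the index `n` here denotes the number of summands, so `qKer q α β γ δ n = K_{n-1}`). -/
def qKer (q α β γ δ : ℂ) (n : ℕ) (s t : ℤ) : ℂ :=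
  ∑ k ∈ Finset.range n,
    qRacah q α β γ δ k s * qRacah q α β γ δ k t / qRacahNormSq q α β γ δ k

/-- `κ_{n-1}(s,t)` (with the same index convention as `qKer`). -/
def qKappa (q α β γ δ A B : ℂ) (n : ℕ) (s t : ℤ) : ℂ :=
  1 + A * qKer q α β γ δ n s s + B * qKer q α β γ δ n t t +
    A * B * (qKer q α β γ δ n s s * qKer q α β γ δ n t t - (qKer q α β γ δ n s t) ^ 2)

/-- The value `R_n^{α,β,A,B}(0)_q` of the `q`-Racah–Krall polynomial at `s = 0`. -/
def qKrall0 (q α β γ δ A B : ℂ) (N n : ℕ) : ℂ :=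
  ((1 + B * qKer q α β γ δ n N N) * qRacah q α β γ δ n 0 -
      B * qKer q α β γ δ n 0 N * qRacah q α β γ δ n N) / qKappa q α β γ δ A B n 0 N

/-- The value `R_n^{α,β,A,B}(N)_q` of the `q`-Racah–Krall polynomial at `s = N`. -/
def qKrallN (q α β γ δ A B : ℂ) (N n : ℕ) : ℂ :=
  (-(A * qKer q α β γ δ n N 0 * qRacah q α β γ δ n 0) +
      (1 + A * qKer q α β γ δ n 0 0) * qRacah q α β γ δ n N) / qKappa q α β γ δ A B n 0 N

/-- The `q`-Racah–Krall polynomial `R_n^{α,β,A,B}(s)_q`. -/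
def qRacahKrall (q α β γ δ A B : ℂ) (N n : ℕ) (s : ℤ) : ℂ :=
  qRacah q α β γ δ n s - A * qKrall0 q α β γ δ A B N n * qKer q α β γ δ n s 0 -
    B * qKrallN q α β γ δ A B N n * qKer q α β γ δ n s N

/-- The TTRR coefficient `β_n` of the standard q-Racah polynomials. -/
def qBetaCoef (q α β γ δ : ℂ) (n : ℕ) : ℂ :=
  1 + δ * γ * q -
    (1 - α * q ^ ((n : ℤ) + 1)) * (1 - α * β * q ^ ((n : ℤ) + 1)) *
        (1 - β * δ * q ^ ((n : ℤ) + 1)) * (1 - γ * q ^ ((n : ℤ) + 1)) /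
      ((1 - α * β * q ^ (2 * (n : ℤ) + 1)) * (1 - α * β * q ^ (2 * (n : ℤ) + 2))) -
    q * (1 - q ^ (n : ℤ)) * (1 - β * q ^ (n : ℤ)) * (γ - α * β * q ^ (n : ℤ)) *
        (δ - α * q ^ (n : ℤ)) /
      ((1 - α * β * q ^ (2 * (n : ℤ))) * (1 - α * β * q ^ (2 * (n : ℤ) + 1)))

/-- The TTRR coefficient `γ_n` of the standard q-Racah polynomials. -/
def qGammaCoef (q α β γ δ : ℂ) (n : ℕ) : ℂ :=
  (1 - α * q ^ (n : ℤ)) * (1 - α * β * q ^ (n : ℤ)) * (1 - β * δ * q ^ (n : ℤ)) *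
      (1 - γ * q ^ (n : ℤ)) /
      ((1 - α * β * q ^ (2 * (n : ℤ) - 1)) * (1 - α * β * q ^ (2 * (n : ℤ)))) *
    (q * (1 - q ^ (n : ℤ)) * (1 - β * q ^ (n : ℤ)) * (γ - α * β * q ^ (n : ℤ)) *
        (δ - α * q ^ (n : ℤ)) /
      ((1 - α * β * q ^ (2 * (n : ℤ))) * (1 - α * β * q ^ (2 * (n : ℤ) + 1))))

/-- The quantity `Δ_m^{α,β,A,B}` from the TTRR of the q-Racah–Krall polynomials. -/
def qDeltaTTRR (q α β γ δ A B : ℂ) (N m : ℕ) : ℂ :=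
  A * qKrall0 q α β γ δ A B N m * qRacah q α β γ δ m 0 / qRacahNormSq q α β γ δ m +
    B * qKrallN q α β γ δ A B N m * qRacah q α β γ δ m (N : ℤ) / qRacahNormSq q α β γ δ m

/-- Kernel polynomials of an abstract sequence. -/
def seqKer (R : ℕ → ℤ → ℂ) (d : ℕ → ℂ) (n : ℕ) (s t : ℤ) : ℂ :=
  ∑ k ∈ Finset.range n, R k s * R k t / d k

theorem seqKer_succ (R : ℕ → ℤ → ℂ) (d : ℕ → ℂ) (n : ℕ) (s t : ℤ) :
    seqKer R d (n + 1) s t = seqKer R d n s t + R n s * R n t / d n :=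
  Finset.sum_range_succ _ _

theorem seqKer_comm (R : ℕ → ℤ → ℂ) (d : ℕ → ℂ) (n : ℕ) (s t : ℤ) :
    seqKer R d n s t = seqKer R d n t s :=
  Finset.sum_congr rfl fun k _ => by rw [mul_comm (R k s)]

/-- The Christoffel–Darboux formula for a sequence satisfying a three-term recurrence. -/
theorem christoffel_darboux (R : ℕ → ℤ → ℂ) (d b g : ℕ → ℂ) (x : ℤ → ℂ) (N : ℕ)
    (hd : ∀ k, k ≤ N → d k ≠ 0) (hg0 : g 0 = 0)
    (hg : ∀ k, k + 1 ≤ N → d (k + 1) = g (k + 1) * d k)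
    (hR : ∀ k, k + 1 ≤ N → ∀ s, x s * R k s = R (k + 1) s + b k * R k s + g k * R (k - 1) s)
    (n : ℕ) (hn : n + 1 ≤ N) (s t : ℤ) :
    (x s - x t) * seqKer R d (n + 1) s t =
      (R (n + 1) s * R n t - R n s * R (n + 1) t) / d n := by
  induction n with
  | zero =>
    have hs := hR 0 hn s
    have ht := hR 0 hn t
    have h0 := hd 0 (by omega)
    rw [seqKer_succ]
    simp only [seqKer, Finset.range_zero, Finset.sum_empty, hg0] at *
    field_simp
    linear_combination R 0 t * hs - R 0 s * ht
  | succ n ih =>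
    have hs := hR (n + 1) hn s
    have ht := hR (n + 1) hn t
    have h0 := hd n (by omega)
    have h1 := hd (n + 1) (by omega)
    have hgn := hg n (by omega)
    rw [seqKer_succ, mul_add, ih (by omega)]
    rw [Nat.add_sub_cancel] at hs ht
    field_simp
    rw [hgn]
    linear_combination d n * (R (n + 1) t * hs - R (n + 1) s * ht)

/-- A three-term recurrence is inherited by the sequence obtained from adding two point masses
`A`, `B` at `0`, `N` to the orthogonality functional, with explicitly modified coefficients. -/
theorem krall_recurrence (R P : ℕ → ℤ → ℂ) (d b g : ℕ → ℂ) (x : ℤ → ℂ) (N : ℕ) (A B : ℂ)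
    (u v : ℤ) (hd : ∀ k, k ≤ N → d k ≠ 0) (hg0 : g 0 = 0)
    (hg : ∀ k, k + 1 ≤ N → d (k + 1) = g (k + 1) * d k)
    (hR : ∀ k, k + 1 ≤ N → ∀ s, x s * R k s = R (k + 1) s + b k * R k s + g k * R (k - 1) s)
    (hκ : ∀ m, (1 + A * seqKer R d m u u) * (1 + B * seqKer R d m v v) -
      A * B * seqKer R d m u v ^ 2 ≠ 0)
    (hP : ∀ m s, P m s =
      R m s - A * P m u * seqKer R d m s u - B * P m v * seqKer R d m s v)
    (n : ℕ) (hn : n + 2 ≤ N) (Δ : ℕ → ℂ)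
    (hΔ : ∀ m, Δ m = A * P m u * R m u / d m + B * P m v * R m v / d m)
    (hdt : 1 + Δ n ≠ 0) (s : ℤ) :
    x s * P (n + 1) s = P (n + 2) s +
      (b (n + 1) - A * (P (n + 1) u * R n u / d n - P (n + 2) u * R (n + 1) u / d (n + 1)) -
        B * (P (n + 1) v * R n v / d n - P (n + 2) v * R (n + 1) v / d (n + 1))) * P (n + 1) s +
      g (n + 1) * ((1 + Δ (n + 1)) / (1 + Δ n)) * P n s := by
  set bt := b (n + 1) - A * (P (n + 1) u * R n u / d n - P (n + 2) u * R (n + 1) u / d (n + 1)) -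
        B * (P (n + 1) v * R n v / d n - P (n + 2) v * R (n + 1) v / d (n + 1)) with hbt
  set gt := g (n + 1) * ((1 + Δ (n + 1)) / (1 + Δ n)) with hgt
  have hgt' : gt * (1 + Δ n) = g (n + 1) * (1 + Δ (n + 1)) := by
    rw [hgt]; field_simp
  rw [hΔ, hΔ] at hgt'
  set e : ℤ → ℂ := fun s => x s * P (n + 1) s - P (n + 2) s - bt * P (n + 1) s - gt * P n s
    with he
  have h0 := hd n (by omega)
  have h1 := hd (n + 1) (by omega)
  have hgn := hg n (by omega)
  have hgne : g (n + 1) ≠ 0 := fun h => h1 (by rw [hgn, h, zero_mul])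
  rw [hgn] at hgt' hbt
  have key : ∀ s, e s =
      -(A * e u * seqKer R d (n + 1) s u) - B * e v * seqKer R d (n + 1) s v := by
    intro s
    have c1 := christoffel_darboux R d b g x N hd hg0 hg hR n (by omega) s u
    have c2 := christoffel_darboux R d b g x N hd hg0 hg hR n (by omega) s v
    have hs := hR (n + 1) (by omega) s
    rw [Nat.add_sub_cancel] at hs
    have p0 := hP n s
    have p1 := hP (n + 1) s
    have p2 := hP (n + 2) s
    have k1 := seqKer_succ R d n s u
    have k2 := seqKer_succ R d n s v
    have k3 := seqKer_succ R d (n + 1) s u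
    have k4 := seqKer_succ R d (n + 1) s v
    rw [hgn] at k3 k4
    rw [show n + 1 + 1 = n + 2 from rfl] at *
    rw [k3, k4] at p2
    have k1' : seqKer R d n s u = seqKer R d (n + 1) s u - R n s * R n u / d n := by
      rw [k1]; ring
    have k2' : seqKer R d n s v = seqKer R d (n + 1) s v - R n s * R n v / d n := by
      rw [k2]; ring
    rw [k1', k2'] at p0
    have e1 : e s = x s * P (n + 1) s - P (n + 2) s - bt * P (n + 1) s - gt * P n s := rfl
    have e2 : e u = x u * P (n + 1) u - P (n + 2) u - bt * P (n + 1) u - gt * P n u := rfl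
    have e3 : e v = x v * P (n + 1) v - P (n + 2) v - bt * P (n + 1) v - gt * P n v := rfl
    rw [e1, e2, e3, p0, p1, p2]
    have hgt2 : gt * (1 + (A * P n u * R n u / d n + B * P n v * R n v / d n)) =
        g (n + 1) + A * P (n + 1) u * R (n + 1) u / d n +
          B * P (n + 1) v * R (n + 1) v / d n := by
      rw [hgt']; field_simp; ring
    linear_combination hs - A * P (n + 1) u * c1 - B * P (n + 1) v * c2 - R (n + 1) s * hbt -
      R n s * hgt2
  have ku := key u
  have kv := key v
  rw [seqKer_comm R d _ v u] at kv
  have hk := hκ (n + 1)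
  have eu : e u = 0 := by
    refine (mul_eq_zero.1 ?_).resolve_left hk
    linear_combination (1 + B * seqKer R d (n + 1) v v) * ku - B * seqKer R d (n + 1) u v * kv
  have ev : e v = 0 := by
    refine (mul_eq_zero.1 ?_).resolve_left hk
    linear_combination (1 + A * seqKer R d (n + 1) u u) * kv - A * seqKer R d (n + 1) u v * ku
  have es := key s
  rw [eu, ev] at es
  simp only [he] at es
  linear_combination es

theorem qPoch_succ (a q : ℂ) (k : ℕ) : qPoch a q (k + 1) = qPoch a q k * (1 - a * q ^ k) :=
  Finset.prod_range_succ _ _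

theorem qPoch_succ_left (a q : ℂ) (k : ℕ) :
    qPoch a q (k + 1) = (1 - a) * qPoch (a * q) q k := by
  unfold qPoch
  rw [Finset.prod_range_succ', mul_comm, pow_zero, mul_one]
  congr 1
  exact Finset.prod_congr rfl fun i _ => by rw [pow_succ']; ring

theorem qPoch_inv_pow_eq_zero {q : ℂ} (hq : q ≠ 0) {n k : ℕ} (h : n < k) :
    qPoch (q ^ n)⁻¹ q k = 0 :=
  Finset.prod_eq_zero (Finset.mem_range.2 h) (by
    rw [inv_mul_cancel₀ (pow_ne_zero _ hq), sub_self])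

/-- The coefficient of `(q^{-s};q)_k (δ γ q^{s+1};q)_k` in the hypergeometric sum defining the
`q`-Racah polynomials. -/
def qRacahCoef (q α β γ δ : ℂ) (n k : ℕ) : ℂ :=
  qPoch (q ^ n)⁻¹ q k * qPoch (α * β * q ^ (n + 1)) q k /
    (qPoch (α * q) q k * qPoch (β * δ * q) q k * qPoch (γ * q) q k * qPoch q q k) * q ^ k

/-- The basis `(q^{-s};q)_k (δ γ q^{s+1};q)_k` of polynomials on the lattice. -/
def qLatBasis (q γ δ : ℂ) (k : ℕ) (s : ℤ) : ℂ :=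
  qPoch (q ^ (-s)) q k * qPoch (δ * γ * q ^ (s + 1)) q k

/-- The factor making the `q`-Racah polynomials monic. -/
def qRacahLead (q α β γ δ : ℂ) (n : ℕ) : ℂ :=
  qPoch (α * q) q n * qPoch (β * δ * q) q n * qPoch (γ * q) q n /
    qPoch (α * β * q ^ (n + 1)) q n

/-- The coefficient of `R_{n+1}` in the recurrence for the unnormalized `q`-Racah polynomials. -/
def qRacahUp (q α β γ δ : ℂ) (n : ℕ) : ℂ :=
  (1 - α * q ^ (n + 1)) * (1 - α * β * q ^ (n + 1)) *
    (1 - β * δ * q ^ (n + 1)) * (1 - γ * q ^ (n + 1)) /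
      ((1 - α * β * q ^ (2 * n + 1)) * (1 - α * β * q ^ (2 * n + 2)))

/-- The coefficient of `R_{n-1}` in the recurrence for the unnormalized `q`-Racah polynomials. -/
def qRacahDown (q α β γ δ : ℂ) (n : ℕ) : ℂ :=
  q * (1 - q ^ n) * (1 - β * q ^ n) * (γ - α * β * q ^ n) * (δ - α * q ^ n) /
    ((1 - α * β * q ^ (2 * n)) * (1 - α * β * q ^ (2 * n + 1)))

theorem qRacahDown_zero (q α β γ δ : ℂ) : qRacahDown q α β γ δ 0 = 0 := by
  simp [qRacahDown]

theorem qRacahCoef_eq_zero {q : ℂ} (hq : q ≠ 0) (α β γ δ : ℂ) {n k : ℕ} (h : n < k) :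
    qRacahCoef q α β γ δ n k = 0 := by
  simp [qRacahCoef, qPoch_inv_pow_eq_zero hq h]

theorem qRacah_eq_sum {q : ℂ} (hq : q ≠ 0) (α β γ δ : ℂ) {n m : ℕ} (h : n + 1 ≤ m) (s : ℤ) :
    qRacah q α β γ δ n s = qRacahLead q α β γ δ n *
      ∑ k ∈ Finset.range m, qRacahCoef q α β γ δ n k * qLatBasis q γ δ k s := by
  have h1 : q ^ ((n : ℤ) + 1) = q ^ (n + 1) := by
    rw [← zpow_natCast]; push_cast; rfl
  have h2 : q ^ (-(n : ℤ)) = (q ^ n)⁻¹ := by rw [zpow_neg, zpow_natCast]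
  rw [← Finset.sum_subset (Finset.range_mono h)
    (fun k _ hk => by
      rw [qRacahCoef_eq_zero hq α β γ δ (by simpa using hk), zero_mul])]
  unfold qRacah qRacahLead qRacahCoef qLatBasis
  rw [h1, h2]
  congr 1
  exact Finset.sum_congr rfl fun k _ => by ring

theorem qLat_mul_qLatBasis {q : ℂ} (hq : q ≠ 0) (γ δ : ℂ) (k : ℕ) (s : ℤ) :
    qLat q γ δ s * qLatBasis q γ δ k s =
      ((q ^ k)⁻¹ + δ * γ * q * q ^ k) * qLatBasis q γ δ k s -
        (q ^ k)⁻¹ * qLatBasis q γ δ (k + 1) s := by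
  unfold qLat qLatBasis
  have hk := pow_ne_zero k hq
  have hs := zpow_ne_zero s hq
  rw [qPoch_succ, qPoch_succ, zpow_add_one₀ hq, zpow_neg]
  field_simp
  ring

theorem qPoch_lower_diff {q : ℂ} (hq : q ≠ 0) (α β γ δ : ℂ) (n j : ℕ)
    (h0 : 1 ≤ n → 1 - α * β * q ^ (2 * n) ≠ 0) (h1 : 1 - α * β * q ^ (2 * n + 1) ≠ 0) :
    qRacahDown q α β γ δ n *
        (qPoch (q ^ n)⁻¹ q (j + 1) * qPoch (α * β * q ^ (n + 1)) q (j + 1) -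
          qPoch (q ^ (n - 1))⁻¹ q (j + 1) * qPoch (α * β * q ^ (n - 1 + 1)) q (j + 1)) =
      q * (1 - β * q ^ n) * (γ - α * β * q ^ n) * (δ - α * q ^ n) /
          (1 - α * β * q ^ (2 * n + 1)) *
        ((1 - q * q ^ j) * qPoch (q ^ n)⁻¹ q (j + 1) * qPoch (α * β * q ^ (n + 1)) q j) := by
  cases n with
  | zero =>
    rw [qRacahDown_zero, qPoch_inv_pow_eq_zero hq (Nat.succ_pos j)]
    ring
  | succ m =>
    have h0 := h0 (by omega)
    rw [Nat.add_sub_cancel]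
    have e1 : (1 - (q ^ (m + 1))⁻¹) * qPoch (q ^ m)⁻¹ q (j + 1) =
        qPoch (q ^ (m + 1))⁻¹ q (j + 1) * (1 - (q ^ (m + 1))⁻¹ * q ^ (j + 1)) := by
      rw [← qPoch_succ, qPoch_succ_left _ _ (j + 1)]
      congr 2
      rw [pow_succ]; field_simp
    have e2 : qPoch (α * β * q ^ (m + 1)) q (j + 1) =
        (1 - α * β * q ^ (m + 1)) * qPoch (α * β * q ^ (m + 1 + 1)) q j := by
      rw [qPoch_succ_left]
      congr 2
      ring
    have e3 : (1 - q ^ (m + 1)) = -q ^ (m + 1) * (1 - (q ^ (m + 1))⁻¹) := by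
      have := pow_ne_zero (m + 1) hq
      field_simp; ring
    rw [e2, qPoch_succ (α * β * q ^ (m + 1 + 1))]
    unfold qRacahDown
    have a1 : q ^ (2 * (m + 1)) = q ^ (m + 1) * q ^ (m + 1) := by ring
    have a2 : q ^ (2 * (m + 1) + 1) = q ^ (m + 1) * q ^ (m + 1) * q := by ring
    rw [a1] at h0
    rw [a2] at h1
    rw [a1, a2, pow_succ q (m + 1)]
    rw [pow_succ q j] at e1
    have hm := pow_ne_zero (m + 1) hq
    set M := q ^ (m + 1)
    set J := q ^ j
    set X := qPoch M⁻¹ q (j + 1)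
    set Z := qPoch (q ^ m)⁻¹ q (j + 1)
    set V := qPoch (α * β * (M * q)) q j
    have e4 : (1 - M) * Z = -M * (X * (1 - M⁻¹ * (J * q))) := by
      rw [← e1, e3]; ring
    have e5 : (1 - M) * (X * (V * (1 - α * β * (M * q) * J)) - Z * ((1 - α * β * M) * V)) =
        (1 - q * J) * (1 - α * β * (M * M)) * X * V := by
      have : (1 - M) * Z = X * (J * q - M) := by rw [e4]; field_simp; ring
      linear_combination (-(1 - α * β * M) * V) * this
    rw [div_mul_eq_mul_div, div_mul_eq_mul_div, div_eq_div_iff (mul_ne_zero h0 h1) h1]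
    linear_combination (q * (1 - β * M) * (γ - α * β * M) * (δ - α * M)) *
      (1 - α * β * (M * M * q)) * e5

theorem qPoch_upper_diff {q : ℂ} (hq : q ≠ 0) (α β γ δ : ℂ) (n j : ℕ)
    (h1 : 1 - α * β * q ^ (2 * n + 1) ≠ 0) (h2 : 1 - α * β * q ^ (2 * n + 2) ≠ 0) :
    qRacahUp q α β γ δ n *
        (qPoch (q ^ (n + 1))⁻¹ q (j + 1) * qPoch (α * β * q ^ (n + 1 + 1)) q (j + 1) -
          qPoch (q ^ n)⁻¹ q (j + 1) * qPoch (α * β * q ^ (n + 1)) q (j + 1)) =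
      -((q ^ (n + 1))⁻¹ * (1 - α * q ^ (n + 1)) * (1 - β * δ * q ^ (n + 1)) *
          (1 - γ * q ^ (n + 1))) / (1 - α * β * q ^ (2 * n + 1)) *
        ((1 - q * q ^ j) * qPoch (q ^ n)⁻¹ q j * qPoch (α * β * q ^ (n + 1)) q (j + 1)) := by
  have e1 : qPoch (q ^ (n + 1))⁻¹ q (j + 1) = (1 - (q ^ (n + 1))⁻¹) * qPoch (q ^ n)⁻¹ q j := by
    rw [qPoch_succ_left]
    congr 2
    rw [pow_succ]; field_simp
  have e2 : (1 - α * β * q ^ (n + 1)) * qPoch (α * β * q ^ (n + 1 + 1)) q (j + 1) =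
      qPoch (α * β * q ^ (n + 1)) q (j + 1) * (1 - α * β * q ^ (n + 1) * q ^ (j + 1)) := by
    rw [← qPoch_succ, qPoch_succ_left _ _ (j + 1)]
    congr 2
    ring
  rw [e1, qPoch_succ (q ^ n)⁻¹]
  unfold qRacahUp
  have a1 : q ^ (2 * n + 1) = q ^ n * q ^ n * q := by ring
  have a2 : q ^ (2 * n + 2) = q ^ n * q ^ n * q * q := by ring
  rw [a1] at h1
  rw [a2] at h2
  rw [pow_succ q j, pow_succ q n] at e2
  rw [a1, a2, pow_succ q n]
  have hm := pow_ne_zero n hq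
  set M := q ^ n
  set J := q ^ j
  set X := qPoch M⁻¹ q j
  set Y := qPoch (α * β * (M * q)) q (j + 1)
  set Z := qPoch (α * β * q ^ (n + 1 + 1)) q (j + 1)
  have e5 : (1 - α * β * (M * q)) * ((1 - (M * q)⁻¹) * X * Z - X * (1 - M⁻¹ * J) * Y) =
      -(M * q)⁻¹ * (1 - q * J) * (1 - α * β * (M * M * q * q)) * X * Y := by
    have : (1 - α * β * (M * q)) * ((1 - (M * q)⁻¹) * X * Z - X * (1 - M⁻¹ * J) * Y) =
      (1 - (M * q)⁻¹) * X * (Y * (1 - α * β * (M * q) * (J * q))) -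
        (1 - α * β * (M * q)) * X * (1 - M⁻¹ * J) * Y := by rw [← e2]; ring
    rw [this]
    field_simp
    ring
  rw [div_mul_eq_mul_div, div_mul_eq_mul_div, div_eq_div_iff (mul_ne_zero h1 h2) h1]
  linear_combination ((1 - α * (M * q)) * (1 - β * δ * (M * q)) * (1 - γ * (M * q))) *
      (1 - α * β * (M * M * q)) * e5

/-- The recurrence for the coefficients of the unnormalized `q`-Racah polynomials. -/
theorem qRacahCoef_recurrence {q : ℂ} (hq : q ≠ 0) (α β γ δ : ℂ) (n j : ℕ)
    (h0 : 1 ≤ n → 1 - α * β * q ^ (2 * n) ≠ 0) (h1 : 1 - α * β * q ^ (2 * n + 1) ≠ 0)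
    (h2 : 1 - α * β * q ^ (2 * n + 2) ≠ 0)
    (hp : qPoch (α * q) q (j + 1) ≠ 0 ∧ qPoch (β * δ * q) q (j + 1) ≠ 0 ∧
      qPoch (γ * q) q (j + 1) ≠ 0 ∧ qPoch q q (j + 1) ≠ 0) :
    ((q ^ (j + 1))⁻¹ + δ * γ * q * q ^ (j + 1) - 1 - δ * γ * q) *
        qRacahCoef q α β γ δ n (j + 1) - (q ^ j)⁻¹ * qRacahCoef q α β γ δ n j =
      qRacahUp q α β γ δ n *
          (qRacahCoef q α β γ δ (n + 1) (j + 1) - qRacahCoef q α β γ δ n (j + 1)) -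
        qRacahDown q α β γ δ n *
          (qRacahCoef q α β γ δ n (j + 1) - qRacahCoef q α β γ δ (n - 1) (j + 1)) := by
  have hL := qPoch_lower_diff hq α β γ δ n j h0 h1
  have hU := qPoch_upper_diff hq α β γ δ n j h1 h2
  obtain ⟨p1, p2, p3, p4⟩ := hp
  have hj := pow_ne_zero j hq
  have hm := pow_ne_zero n hq
  set W := q ^ (j + 1) / (qPoch (α * q) q (j + 1) * qPoch (β * δ * q) q (j + 1) *
    qPoch (γ * q) q (j + 1) * qPoch q q (j + 1)) with hW
  have c : ∀ m, qRacahCoef q α β γ δ m (j + 1) =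
      qPoch (q ^ m)⁻¹ q (j + 1) * qPoch (α * β * q ^ (m + 1)) q (j + 1) * W := by
    intro m; rw [hW]; unfold qRacahCoef; ring
  have c' : qRacahCoef q α β γ δ n j = qPoch (q ^ n)⁻¹ q j * qPoch (α * β * q ^ (n + 1)) q j *
      (W * ((1 - α * (q * q ^ j)) * (1 - β * δ * (q * q ^ j)) * (1 - γ * (q * q ^ j)) *
        (1 - q * q ^ j)) / q) := by
    rw [hW]; unfold qRacahCoef
    rw [qPoch_succ] at p1 p2 p3 p4
    simp only [qPoch_succ, pow_succ q j]
    have := right_ne_zero_of_mul p1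
    have := right_ne_zero_of_mul p2
    have := right_ne_zero_of_mul p3
    have := right_ne_zero_of_mul p4
    have := left_ne_zero_of_mul p1
    have := left_ne_zero_of_mul p2
    have := left_ne_zero_of_mul p3
    have := left_ne_zero_of_mul p4
    rw [← mul_assoc α, ← mul_assoc (β * δ), ← mul_assoc γ]
    generalize 1 - α * q * q ^ j = y₁ at *
    generalize 1 - β * δ * q * q ^ j = y₂ at *
    generalize 1 - γ * q * q ^ j = y₃ at *
    generalize 1 - q * q ^ j = y₄ at *
    generalize qPoch (α * q) q j = z₁ at *
    generalize qPoch (β * δ * q) q j = z₂ at *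
    generalize qPoch (γ * q) q j = z₃ at *
    field_simp
  rw [c, c, c, c', ← sub_mul, ← sub_mul, ← mul_assoc (qRacahUp q α β γ δ n),
    ← mul_assoc (qRacahDown q α β γ δ n),
    hU, hL, qPoch_succ (q ^ n)⁻¹, qPoch_succ (α * β * q ^ (n + 1))]
  have a1 : q ^ (2 * n + 1) = q ^ n * q ^ n * q := by ring
  rw [a1] at h1
  rw [a1, pow_succ q j, pow_succ q n]
  clear hL hU h0 h2 c c' hW p1 p2 p3 p4
  generalize qPoch (q ^ n)⁻¹ q j = X
  generalize qPoch (α * β * (q ^ n * q)) q j = Y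
  clear_value W
  generalize q ^ n = M at *
  generalize q ^ j = J at *
  generalize hD : 1 - α * β * (M * M * q) = D at *
  field_simp
  rw [← hD]
  ring

/-- The three-term recurrence for the `q`-Racah polynomials, before normalization. -/
theorem qRacah_sum_recurrence {q : ℂ} (hq : q ≠ 0) (α β γ δ : ℂ) (n : ℕ)
    (h0 : 1 ≤ n → 1 - α * β * q ^ (2 * n) ≠ 0) (h1 : 1 - α * β * q ^ (2 * n + 1) ≠ 0)
    (h2 : 1 - α * β * q ^ (2 * n + 2) ≠ 0)
    (hp : ∀ k ≤ n + 1, qPoch (α * q) q k ≠ 0 ∧ qPoch (β * δ * q) q k ≠ 0 ∧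
      qPoch (γ * q) q k ≠ 0 ∧ qPoch q q k ≠ 0) (s : ℤ) (S : ℕ → ℂ)
    (hS : ∀ m, S m = ∑ k ∈ Finset.range (n + 2),
      qRacahCoef q α β γ δ m k * qLatBasis q γ δ k s) :
    (qLat q γ δ s - 1 - δ * γ * q) * S n =
      qRacahUp q α β γ δ n * (S (n + 1) - S n) -
        qRacahDown q α β γ δ n * (S n - S (n - 1)) := by
  have hz : ∀ m, qRacahCoef q α β γ δ m 0 = 1 := by
    intro m; simp [qRacahCoef, qPoch]
  have hl : (qLat q γ δ s - 1 - δ * γ * q) * S n =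
      ∑ j ∈ Finset.range (n + 1), (((q ^ (j + 1))⁻¹ + δ * γ * q * q ^ (j + 1) - 1 - δ * γ * q) *
        qRacahCoef q α β γ δ n (j + 1) - (q ^ j)⁻¹ * qRacahCoef q α β γ δ n j) *
          qLatBasis q γ δ (j + 1) s := by
    have hb : (qLat q γ δ s - 1 - δ * γ * q) * S n =
        ∑ k ∈ Finset.range (n + 2), ((q ^ k)⁻¹ + δ * γ * q * q ^ k - 1 - δ * γ * q) *
            qRacahCoef q α β γ δ n k * qLatBasis q γ δ k s -
          ∑ k ∈ Finset.range (n + 2),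
            (q ^ k)⁻¹ * qRacahCoef q α β γ δ n k * qLatBasis q γ δ (k + 1) s := by
      rw [hS, Finset.mul_sum, ← Finset.sum_sub_distrib]
      refine Finset.sum_congr rfl fun k _ => ?_
      linear_combination qRacahCoef q α β γ δ n k * qLat_mul_qLatBasis hq γ δ k s
    rw [hb, Finset.sum_range_succ', Finset.sum_range_succ _ (n + 1),
      qRacahCoef_eq_zero hq α β γ δ (Nat.lt_succ_self n)]
    simp only [sub_mul, Finset.sum_sub_distrib, pow_zero]
    ring
  have hd : ∀ m l, S m - S l = ∑ j ∈ Finset.range (n + 1),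
      (qRacahCoef q α β γ δ m (j + 1) - qRacahCoef q α β γ δ l (j + 1)) *
        qLatBasis q γ δ (j + 1) s := by
    intro m l
    rw [hS, hS, Finset.sum_range_succ', Finset.sum_range_succ' _ (n + 1), hz, hz]
    simp only [sub_mul, Finset.sum_sub_distrib]
    ring
  rw [hl, hd, hd, Finset.mul_sum, Finset.mul_sum, ← Finset.sum_sub_distrib]
  refine Finset.sum_congr rfl fun j hj => ?_
  rw [qRacahCoef_recurrence hq α β γ δ n j h0 h1 h2
    (hp _ (by have := Finset.mem_range.1 hj; omega))]
  ring

theorem qPoch_mul_pow_succ (a q : ℂ) (n : ℕ) :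
    (1 - a * q ^ (n + 1)) * qPoch (a * q ^ (n + 1 + 1)) q (n + 1) =
      qPoch (a * q ^ (n + 1)) q n * (1 - a * q ^ (2 * n + 1)) * (1 - a * q ^ (2 * n + 2)) := by
  have h : a * q ^ (n + 1 + 1) = a * q ^ (n + 1) * q := by ring
  rw [h, ← qPoch_succ_left, qPoch_succ, qPoch_succ]
  ring

theorem qRacahLead_succ (q α β γ δ : ℂ) (n : ℕ)
    (h1 : qPoch (α * β * q ^ (n + 1)) q n ≠ 0)
    (h2 : qPoch (α * β * q ^ (n + 1 + 1)) q (n + 1) ≠ 0)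
    (h3 : 1 - α * β * q ^ (2 * n + 1) ≠ 0) (h4 : 1 - α * β * q ^ (2 * n + 2) ≠ 0) :
    qRacahLead q α β γ δ (n + 1) = qRacahUp q α β γ δ n * qRacahLead q α β γ δ n := by
  have h := qPoch_mul_pow_succ (α * β) q n
  unfold qRacahLead qRacahUp
  rw [div_mul_div_comm, div_eq_div_iff h2 (mul_ne_zero (mul_ne_zero h3 h4) h1)]
  simp only [qPoch_succ _ _ n] at *
  rw [pow_succ q n] at *
  linear_combination (-(qPoch (α * q) q n * (1 - α * q * q ^ n) *
      (qPoch (β * δ * q) q n * (1 - β * δ * q * q ^ n)) *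
      (qPoch (γ * q) q n * (1 - γ * q * q ^ n)))) * h

theorem qRacahNormSq_succ {q : ℂ} (α β γ δ : ℂ) (n : ℕ)
    (hd : qRacahNormSq q α β γ δ (n + 1) ≠ 0) :
    qRacahNormSq q α β γ δ (n + 1) =
      qRacahUp q α β γ δ n * qRacahDown q α β γ δ (n + 1) * qRacahNormSq q α β γ δ n := by
  have hγ : γ ≠ 0 := by
    rintro rfl; exact hd (by simp [qRacahNormSq])
  have hδ : δ ≠ 0 := by
    rintro rfl; exact hd (by simp [qRacahNormSq])
  have hT : qPoch (α * β * q) q (n + 1) ≠ 0 := fun h => hd (by simp [qRacahNormSq, h])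
  have z1 : ∀ m : ℕ, q ^ ((m : ℤ) + 1) = q ^ (m + 1) := fun m => by
    rw [← zpow_natCast]; push_cast; rfl
  have z2 : ∀ m : ℕ, q ^ (2 * (m : ℤ) + 1) = q ^ (2 * m + 1) := fun m => by
    rw [← zpow_natCast]; push_cast; rfl
  have hL := qPoch_mul_pow_succ (α * β) q n
  have g1 : γ * (1 - q * α * β * γ⁻¹ * q ^ n) = γ - α * β * q ^ (n + 1) := by
    field_simp; ring
  have g2 : δ * (1 - α * δ⁻¹ * q * q ^ n) = δ - α * q ^ (n + 1) := by
    field_simp; ring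
  rw [qPoch_succ] at hT
  have hE := right_ne_zero_of_mul hT
  rw [show α * β * q * q ^ n = α * β * q ^ (n + 1) by ring] at hE
  unfold qRacahNormSq qRacahUp qRacahDown
  rw [z1, z1, z2, z2, ← g1, ← g2]
  have hden : qPoch (α * β * q) q n * (1 - α * β * q ^ (n + 1)) *
        qPoch (α * β * q ^ (n + 1 + 1)) q (n + 1) * qPoch (α * β * q ^ (n + 1 + 1)) q (n + 1) =
      qPoch (α * β * q) q n * (qPoch (α * β * q ^ (n + 1)) q n) ^ 2 *
        (1 - α * β * q ^ (2 * n + 1)) ^ 2 * (1 - α * β * q ^ (2 * n + 2)) ^ 2 *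
          (1 - α * β * q ^ (n + 1))⁻¹ := by
    rw [eq_mul_inv_iff_mul_eq₀ hE]
    linear_combination qPoch (α * β * q) q n * ((1 - α * β * q ^ (n + 1)) *
      qPoch (α * β * q ^ (n + 1 + 1)) q (n + 1) + qPoch (α * β * q ^ (n + 1)) q n *
        (1 - α * β * q ^ (2 * n + 1)) * (1 - α * β * q ^ (2 * n + 2))) * hL
  rw [qPoch_succ (α * β * q) q n, show α * β * q * q ^ n = α * β * q ^ (n + 1) by ring, hden]
  simp only [qPoch_succ _ _ n]
  rw [show 2 * (n + 1) + 1 = 2 * n + 3 by ring, show 2 * (n + 1) = 2 * n + 2 by ring,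
    show α * q * q ^ n = α * q ^ (n + 1) by ring,
    show β * δ * q * q ^ n = β * δ * q ^ (n + 1) by ring,
    show γ * q * q ^ n = γ * q ^ (n + 1) by ring,
    show β * q * q ^ n = β * q ^ (n + 1) by ring, show q * q ^ n = q ^ (n + 1) by ring,
    pow_succ (δ * γ * q) n]
  generalize qPoch (α * β * q ^ (n + 1)) q n = L
  generalize qPoch (α * β * q) q n = T
  generalize 1 - α * β * q ^ (n + 1) = E
  generalize 1 - α * β * q ^ (2 * n + 1) = F₁
  generalize 1 - α * β * q ^ (2 * n + 2) = F₂
  generalize 1 - α * β * q ^ (2 * n + 3) = F₃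
  generalize 1 - q * α * β * γ⁻¹ * q ^ n = G₁
  generalize 1 - α * δ⁻¹ * q * q ^ n = G₂
  generalize qPoch (q * α * β * γ⁻¹) q n = U₁
  generalize qPoch (α * δ⁻¹ * q) q n = U₂
  generalize 1 - α * q ^ (n + 1) = f₁
  generalize 1 - β * δ * q ^ (n + 1) = f₂
  generalize 1 - γ * q ^ (n + 1) = f₃
  generalize 1 - β * q ^ (n + 1) = f₄
  generalize 1 - q ^ (n + 1) = f₅
  generalize (δ * γ * q) ^ n = p
  generalize 1 - α * β * q = c
  obtain ⟨K, rfl⟩ : ∃ K, E = K⁻¹ := ⟨E⁻¹, (inv_inv E).symm⟩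
  rw [inv_inv]
  ring

theorem qGammaCoef_zero (q α β γ δ : ℂ) : qGammaCoef q α β γ δ 0 = 0 := by
  simp [qGammaCoef]

theorem qGammaCoef_succ (q α β γ δ : ℂ) (n : ℕ) :
    qGammaCoef q α β γ δ (n + 1) = qRacahUp q α β γ δ n * qRacahDown q α β γ δ (n + 1) := by
  unfold qGammaCoef qRacahUp qRacahDown
  have z0 : q ^ ((n + 1 : ℕ) : ℤ) = q ^ (n + 1) := zpow_natCast _ _
  have z1 : q ^ (2 * ((n + 1 : ℕ) : ℤ) - 1) = q ^ (2 * n + 1) := by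
    rw [← zpow_natCast]; congr 1; push_cast; ring
  have z2 : q ^ (2 * ((n + 1 : ℕ) : ℤ)) = q ^ (2 * n + 2) := by
    rw [← zpow_natCast]; congr 1
  have z3 : q ^ (2 * ((n + 1 : ℕ) : ℤ) + 1) = q ^ (2 * (n + 1) + 1) := by
    rw [← zpow_natCast]; congr 1
  rw [z0, z1, z2, z3, show 2 * (n + 1) = 2 * n + 2 by ring]

theorem qBetaCoef_eq (q α β γ δ : ℂ) (n : ℕ) :
    qBetaCoef q α β γ δ n =
      1 + δ * γ * q - qRacahUp q α β γ δ n - qRacahDown q α β γ δ n := by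
  unfold qBetaCoef qRacahUp qRacahDown
  have z0 : q ^ (n : ℤ) = q ^ n := zpow_natCast _ _
  have z1 : q ^ ((n : ℤ) + 1) = q ^ (n + 1) := by
    rw [← zpow_natCast]; congr 1
  have z2 : q ^ (2 * (n : ℤ)) = q ^ (2 * n) := by
    rw [← zpow_natCast]; congr 1
  have z3 : q ^ (2 * (n : ℤ) + 1) = q ^ (2 * n + 1) := by
    rw [← zpow_natCast]; congr 1
  have z4 : q ^ (2 * (n : ℤ) + 2) = q ^ (2 * n + 2) := by
    rw [← zpow_natCast]; congr 1
  rw [z0, z1, z2, z3, z4]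

/-- The three-term recurrence for the `q`-Racah polynomials. -/
theorem qRacah_recurrence {q : ℂ} (hq : q ≠ 0) (α β γ δ : ℂ) (N : ℕ)
    (hpoch : ∀ k ≤ N, qPoch (α * q) q k ≠ 0 ∧ qPoch (β * δ * q) q k ≠ 0 ∧
      qPoch (γ * q) q k ≠ 0 ∧ qPoch q q k ≠ 0)
    (hpoch2 : ∀ k ≤ N, qPoch (α * β * q ^ (k + 1)) q k ≠ 0)
    (hodd : ∀ k ≤ N, 1 - α * β * q ^ (2 * k + 1) ≠ 0)
    (heven : ∀ k, k + 1 ≤ N → 1 - α * β * q ^ (2 * k + 2) ≠ 0)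
    (n : ℕ) (hn : n + 1 ≤ N) (s : ℤ) :
    qLat q γ δ s * qRacah q α β γ δ n s = qRacah q α β γ δ (n + 1) s +
      qBetaCoef q α β γ δ n * qRacah q α β γ δ n s +
        qGammaCoef q α β γ δ n * qRacah q α β γ δ (n - 1) s := by
  have h0 : 1 ≤ n → 1 - α * β * q ^ (2 * n) ≠ 0 := fun h => by
    obtain ⟨m, rfl⟩ := Nat.exists_eq_add_of_le' h
    exact heven m (by omega)
  have hrec := qRacah_sum_recurrence hq α β γ δ n h0 (hodd n (by omega)) (heven n hn)
    (fun k hk => hpoch k (by omega)) s _ (fun _ => rfl)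
  have l1 := qRacahLead_succ q α β γ δ n (hpoch2 n (by omega)) (hpoch2 (n + 1) hn)
    (hodd n (by omega)) (heven n hn)
  rw [qRacah_eq_sum hq (n := n) (m := n + 2) α β γ δ (by omega),
    qRacah_eq_sum hq (n := n + 1) (m := n + 2) α β γ δ (by omega),
    qRacah_eq_sum hq (n := n - 1) (m := n + 2) α β γ δ (by omega), l1, qBetaCoef_eq]
  have hg : qGammaCoef q α β γ δ n * qRacahLead q α β γ δ (n - 1) =
      qRacahDown q α β γ δ n * qRacahLead q α β γ δ n := by
    cases n with
    | zero => rw [qGammaCoef_zero, qRacahDown_zero, zero_mul]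
    | succ m =>
      rw [Nat.add_sub_cancel, qGammaCoef_succ, qRacahLead_succ q α β γ δ m
        (hpoch2 m (by omega)) (hpoch2 (m + 1) (by omega)) (hodd m (by omega))
        (heven m (by omega))]
      ring
  rw [← mul_assoc (qGammaCoef q α β γ δ n), hg]
  linear_combination qRacahLead q α β γ δ n * hrec

theorem qKer_eq_seqKer (q α β γ δ : ℂ) :
    qKer q α β γ δ = seqKer (qRacah q α β γ δ) (qRacahNormSq q α β γ δ) := rfl

theorem qKer_comm (q α β γ δ : ℂ) (n : ℕ) (s t : ℤ) :
    qKer q α β γ δ n s t = qKer q α β γ δ n t s :=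
  seqKer_comm _ _ n s t

theorem qRacahKrall_zero (q α β γ δ A B : ℂ) (N n : ℕ)
    (hκ : qKappa q α β γ δ A B n 0 N ≠ 0) :
    qRacahKrall q α β γ δ A B N n 0 = qKrall0 q α β γ δ A B N n := by
  unfold qRacahKrall qKrall0 qKrallN
  rw [qKer_comm _ _ _ _ _ n N 0]
  generalize h : qKappa q α β γ δ A B n 0 N = κ at *
  field_simp
  rw [← h]
  unfold qKappa
  ring

theorem qRacahKrall_self (q α β γ δ A B : ℂ) (N n : ℕ)
    (hκ : qKappa q α β γ δ A B n 0 N ≠ 0) :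
    qRacahKrall q α β γ δ A B N n N = qKrallN q α β γ δ A B N n := by
  unfold qRacahKrall qKrall0 qKrallN
  rw [qKer_comm _ _ _ _ _ n N 0]
  generalize h : qKappa q α β γ δ A B n 0 N = κ at *
  field_simp
  rw [← h]
  unfold qKappa
  ring

/-- the three-term recurrence relation for the q-Racah–Krall polynomials. -/
theorem qRacahKrall_TTRR
    (q : ℝ) (hq0 : 0 < q) (hq1 : q < 1) (α β γ δ : ℂ) (N : ℕ)
    (htrunc : α * (q : ℂ) = (q : ℂ) ^ (-(N : ℤ)) ∨ β * δ * (q : ℂ) = (q : ℂ) ^ (-(N : ℤ)) ∨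
      γ * (q : ℂ) = (q : ℂ) ^ (-(N : ℤ)))
    (hpoch : ∀ k : ℕ, k ≤ N → qPoch (α * (q : ℂ)) (q : ℂ) k ≠ 0 ∧
      qPoch (β * δ * (q : ℂ)) (q : ℂ) k ≠ 0 ∧ qPoch (γ * (q : ℂ)) (q : ℂ) k ≠ 0 ∧
      qPoch (q : ℂ) (q : ℂ) k ≠ 0)
    (hpoch2 : ∀ k : ℕ, k ≤ N → qPoch (α * β * (q : ℂ) ^ ((k : ℤ) + 1)) (q : ℂ) k ≠ 0)
    (hnorm : ∀ k : ℕ, k ≤ N → qRacahNormSq (q : ℂ) α β γ δ k ≠ 0)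
    (A B : ℂ)
    (hκ : ∀ m : ℕ, qKappa (q : ℂ) α β γ δ A B m 0 (N : ℤ) ≠ 0)
    (n : ℕ) (hn1 : 1 ≤ n) (hnN : n + 1 ≤ N)
    (hdt : qRacahNormSq (q : ℂ) α β γ δ (n - 1) *
      (1 + qDeltaTTRR (q : ℂ) α β γ δ A B N (n - 1)) ≠ 0) :
    ∀ s : ℤ,
      qLat (q : ℂ) γ δ s * qRacahKrall (q : ℂ) α β γ δ A B N n s =
        qRacahKrall (q : ℂ) α β γ δ A B N (n + 1) s +
          (qBetaCoef (q : ℂ) α β γ δ n -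
            A * (qKrall0 (q : ℂ) α β γ δ A B N n * qRacah (q : ℂ) α β γ δ (n - 1) 0 /
                qRacahNormSq (q : ℂ) α β γ δ (n - 1) -
              qKrall0 (q : ℂ) α β γ δ A B N (n + 1) * qRacah (q : ℂ) α β γ δ n 0 /
                qRacahNormSq (q : ℂ) α β γ δ n) -
            B * (qKrallN (q : ℂ) α β γ δ A B N n * qRacah (q : ℂ) α β γ δ (n - 1) (N : ℤ) /
                qRacahNormSq (q : ℂ) α β γ δ (n - 1) -
              qKrallN (q : ℂ) α β γ δ A B N (n + 1) * qRacah (q : ℂ) α β γ δ n (N : ℤ) /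
                qRacahNormSq (q : ℂ) α β γ δ n)) *
            qRacahKrall (q : ℂ) α β γ δ A B N n s +
          qGammaCoef (q : ℂ) α β γ δ n *
              ((1 + qDeltaTTRR (q : ℂ) α β γ δ A B N n) /
                (1 + qDeltaTTRR (q : ℂ) α β γ δ A B N (n - 1))) *
            qRacahKrall (q : ℂ) α β γ δ A B N (n - 1) s := by
  have hq : (q : ℂ) ≠ 0 := by exact_mod_cast hq0.ne'
  have z1 : ∀ m : ℕ, (q : ℂ) ^ ((m : ℤ) + 1) = (q : ℂ) ^ (m + 1) := fun m => by
    rw [← zpow_natCast]; push_cast; rfl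
  simp only [z1] at hpoch2
  have hodd : ∀ k ≤ N, 1 - α * β * (q : ℂ) ^ (2 * k + 1) ≠ 0 := fun k hk h => by
    refine hnorm k hk ?_
    have z2 : (q : ℂ) ^ (2 * (k : ℤ) + 1) = (q : ℂ) ^ (2 * k + 1) := by
      rw [← zpow_natCast]; push_cast; rfl
    simp [qRacahNormSq, z2, h]
  have heven : ∀ k, k + 1 ≤ N → 1 - α * β * (q : ℂ) ^ (2 * k + 2) ≠ 0 := fun k hk h => by
    have h' := hpoch2 (k + 1) hk
    rw [qPoch_succ] at h'
    refine right_ne_zero_of_mul h' ?_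
    rw [← h]; ring
  have hR := qRacah_recurrence hq α β γ δ N hpoch hpoch2 hodd heven
  have hg : ∀ k, k + 1 ≤ N → qRacahNormSq (q : ℂ) α β γ δ (k + 1) =
      qGammaCoef (q : ℂ) α β γ δ (k + 1) * qRacahNormSq (q : ℂ) α β γ δ k := fun k hk => by
    rw [qGammaCoef_succ]
    exact qRacahNormSq_succ α β γ δ k (hnorm _ hk)
  obtain ⟨m, rfl⟩ := Nat.exists_eq_add_of_le' hn1
  have P0 := fun k => qRacahKrall_zero (q : ℂ) α β γ δ A B N k (hκ k)
  have PN := fun k => qRacahKrall_self (q : ℂ) α β γ δ A B N k (hκ k)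
  intro s
  have key := krall_recurrence (qRacah (q : ℂ) α β γ δ) (qRacahKrall (q : ℂ) α β γ δ A B N)
    (qRacahNormSq (q : ℂ) α β γ δ) (qBetaCoef (q : ℂ) α β γ δ) (qGammaCoef (q : ℂ) α β γ δ)
    (qLat (q : ℂ) γ δ) N A B 0 N hnorm (qGammaCoef_zero _ _ _ _ _) hg hR
    (fun k h => hκ k (by
      rw [← h, qKappa, qKer_eq_seqKer]; ring))
    (fun k t => by rw [P0, PN]; rfl) m hnN (qDeltaTTRR (q : ℂ) α β γ δ A B N)
    (fun k => by rw [P0, PN]; rfl) (right_ne_zero_of_mul hdt) s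
  simp only [P0, PN] at key
  exact key
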